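/- (Orthogonality relations / Moyal-type formula.) Let A be a real invertible (2d)×(2d) matrix. Then for all Schwartz functions f₁, f₂, g₁, g₂ : ℝ^d → ℂ, ∬_{ℝ^{2d}} B_A(f₁,g₁)(x,ω) · conj(B_A(f₂,g₂)(x,ω)) dx dω = |det A|^{-1} · (∫_{ℝ^d} f₁(t) conj(f₂(t)) dt) · conj(∫_{ℝ^d} g₁(t) conj(g₂(t)) dt). In particular, ‖B_A(f,g)‖_{L²(ℝ^{2d})} = |det A|^{-1/2} ‖f‖_{L²} ‖g‖_{L²}. -/

import Mathlib

open MeasureTheory Matrix ComplexConjugate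
open scoped Real Matrix

/-- The matrix-Wigner distribution `B_A(f,g)` associated with the `2d × 2d` matrix with
`d × d` blocks `A₁₁, A₁₂, A₂₁, A₂₂`. -/
noncomputable def mwd {d : ℕ} (A₁₁ A₁₂ A₂₁ A₂₂ : Matrix (Fin d) (Fin d) ℝ)
    (f g : (Fin d → ℝ) → ℂ) (x ω : Fin d → ℝ) : ℂ :=
  ∫ y : Fin d → ℝ,
    Complex.exp (-2 * (Real.pi : ℂ) * Complex.I * ((ω ⬝ᵥ y : ℝ) : ℂ)) *
      f (A₁₁.mulVec x + A₁₂.mulVec y) * conj (g (A₂₁.mulVec x + A₂₂.mulVec y))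

open scoped SchwartzMap ENNReal FourierTransform

namespace SchwartzMap

variable {E F : Type*} [NormedAddCommGroup E] [NormedSpace ℝ E]
  [NormedAddCommGroup F] [NormedSpace ℝ F]

theorem norm_iteratedFDeriv_comp_clm_le (f : 𝓢(E, ℂ)) (L : F →L[ℝ] E) (hL : ‖L‖ ≤ 1) (n : ℕ)
    (x : F) : ‖iteratedFDeriv ℝ n (f ∘ L) x‖ ≤ ‖iteratedFDeriv ℝ n f (L x)‖ := by
  rw [L.iteratedFDeriv_comp_right (f.smooth n) x le_rfl]
  refine (ContinuousMultilinearMap.norm_compContinuousLinearMap_le _ _).trans ?_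
  refine mul_le_of_le_one_right (norm_nonneg _) ?_
  simpa using pow_le_one₀ (norm_nonneg L) hL

/-- The tensor product `(u, v) ↦ f u * g v` of two complex-valued Schwartz functions. -/
noncomputable def tensor (f : 𝓢(E, ℂ)) (g : 𝓢(F, ℂ)) : 𝓢(E × F, ℂ) where
  toFun z := f z.1 * g z.2
  smooth' := ((f.smooth ⊤).comp contDiff_fst).mul ((g.smooth ⊤).comp contDiff_snd)
  decay' k n := by
    choose Cf _ hCf using fun p : ℕ × ℕ => f.decay p.1 p.2
    choose Cg _ hCg using fun p : ℕ × ℕ => g.decay p.1 p.2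
    refine ⟨∑ i ∈ Finset.range (n + 1), (n.choose i : ℝ) *
      (Cf (k, i) * Cg (0, n - i) + Cf (0, i) * Cg (k, n - i)), fun z => ?_⟩
    have hmul := norm_iteratedFDeriv_mul_le (𝕜 := ℝ) (n := n)
      (f := fun z : E × F => f z.1) (g := fun z : E × F => g z.2) (N := (⊤ : ℕ∞))
      ((f.smooth ⊤).comp contDiff_fst) ((g.smooth ⊤).comp contDiff_snd) z
      (by exact_mod_cast le_top)
    refine (mul_le_mul_of_nonneg_left hmul (by positivity)).trans ?_
    rw [Finset.mul_sum]
    refine Finset.sum_le_sum fun i _ => ?_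
    have hf := f.norm_iteratedFDeriv_comp_clm_le (.fst ℝ E F)
      (ContinuousLinearMap.norm_fst_le ..) i z
    have hg := g.norm_iteratedFDeriv_comp_clm_le (.snd ℝ E F)
      (ContinuousLinearMap.norm_snd_le ..) (n - i) z
    have hk : ‖z‖ ^ k ≤ ‖z.1‖ ^ k + ‖z.2‖ ^ k := by
      rcases max_choice ‖z.1‖ ‖z.2‖ with h | h <;> rw [Prod.norm_def, h] <;>
        linarith [pow_nonneg (norm_nonneg z.1) k, pow_nonneg (norm_nonneg z.2) k]
    have hf0 := hCf (0, i) z.1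
    have hfk := hCf (k, i) z.1
    have hg0 := hCg (0, n - i) z.2
    have hgk := hCg (k, n - i) z.2
    simp only [pow_zero, one_mul] at hf0 hg0
    calc ‖z‖ ^ k * (n.choose i * ‖iteratedFDeriv ℝ i (fun z : E × F => f z.1) z‖ *
          ‖iteratedFDeriv ℝ (n - i) (fun z : E × F => g z.2) z‖)
        ≤ (‖z.1‖ ^ k + ‖z.2‖ ^ k) * (n.choose i * ‖iteratedFDeriv ℝ i f z.1‖ *
          ‖iteratedFDeriv ℝ (n - i) g z.2‖) := by gcongr <;> assumption
      _ = n.choose i * ((‖z.1‖ ^ k * ‖iteratedFDeriv ℝ i f z.1‖) *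
            ‖iteratedFDeriv ℝ (n - i) g z.2‖ +
          ‖iteratedFDeriv ℝ i f z.1‖ * (‖z.2‖ ^ k * ‖iteratedFDeriv ℝ (n - i) g z.2‖)) := by ring
      _ ≤ _ := by
        have := (norm_nonneg _).trans hf0
        have := (mul_nonneg (by positivity) (norm_nonneg _)).trans hfk
        gcongr

@[simp]
theorem tensor_apply (f : 𝓢(E, ℂ)) (g : 𝓢(F, ℂ)) (z : E × F) : tensor f g z = f z.1 * g z.2 :=
  rfl

/-- The pointwise complex conjugate of a Schwartz function. -/
noncomputable def conjugate (f : 𝓢(E, ℂ)) : 𝓢(E, ℂ) :=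
  f.postcompCLM (Complex.conjCLE : ℂ →L[ℝ] ℂ)

@[simp]
theorem conjugate_apply (f : 𝓢(E, ℂ)) (x : E) : conjugate f x = conj (f x) := rfl

theorem eLpNorm_conjugate [MeasurableSpace E] (f : 𝓢(E, ℂ)) (p : ℝ≥0∞) (μ : Measure E) :
    eLpNorm (conjugate f) p μ = eLpNorm f p μ :=
  eLpNorm_congr_norm_ae (ae_of_all _ fun _ => by simp)

end SchwartzMap

theorem eLpNorm_two_sq {α : Type*} [MeasurableSpace α] (μ : Measure α) (f : α → ℂ) :
    eLpNorm f 2 μ ^ 2 = ∫⁻ x, ‖f x‖ₑ ^ 2 ∂μ := by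
  simpa using eLpNorm_nnreal_pow_eq_lintegral (μ := μ) (f := f) (p := 2) two_ne_zero

theorem eLpNorm_two_eq_of_lintegral_eq {α β : Type*} [MeasurableSpace α] [MeasurableSpace β]
    {μ : Measure α} {ν : Measure β} {f : α → ℂ} {g : β → ℂ}
    (h : ∫⁻ x, ‖f x‖ₑ ^ 2 ∂μ = ∫⁻ x, ‖g x‖ₑ ^ 2 ∂ν) : eLpNorm f 2 μ = eLpNorm g 2 ν := by
  rw [← eLpNorm_two_sq, ← eLpNorm_two_sq] at h
  exact (ENNReal.pow_right_strictMono two_ne_zero).injective h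

/-- The `L²` norm of an elementary tensor is the product of the `L²` norms. -/
theorem eLpNorm_two_prod_mul {α β : Type*} [MeasurableSpace α] [MeasurableSpace β]
    {μ : Measure α} {ν : Measure β} [SFinite ν] {f : α → ℂ} {g : β → ℂ}
    (hf : AEStronglyMeasurable f μ) (hg : AEStronglyMeasurable g ν) :
    eLpNorm (fun z : α × β => f z.1 * g z.2) 2 (μ.prod ν) = eLpNorm f 2 μ * eLpNorm g 2 ν := by
  apply (ENNReal.pow_right_strictMono two_ne_zero).injective
  simp only [mul_pow, eLpNorm_two_sq, enorm_mul]
  exact lintegral_prod_mul (hf.enorm.pow_const 2) (hg.enorm.pow_const 2)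

/-- The linear map of `ℝ^d × ℝ^d` with the given `d × d` blocks. -/
noncomputable def blockMap {d : ℕ} (A₁₁ A₁₂ A₂₁ A₂₂ : Matrix (Fin d) (Fin d) ℝ)
    (z : (Fin d → ℝ) × (Fin d → ℝ)) : (Fin d → ℝ) × (Fin d → ℝ) :=
  (A₁₁.mulVec z.1 + A₁₂.mulVec z.2, A₂₁.mulVec z.1 + A₂₂.mulVec z.2)

section Block

variable {d : ℕ} {A₁₁ A₁₂ A₂₁ A₂₂ : Matrix (Fin d) (Fin d) ℝ}

theorem continuous_blockMap : Continuous (blockMap A₁₁ A₁₂ A₂₁ A₂₂) := by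
  unfold blockMap; fun_prop

theorem map_blockMap_volume (hA : (fromBlocks A₁₁ A₁₂ A₂₁ A₂₂).det ≠ 0) :
    Measure.map (blockMap A₁₁ A₁₂ A₂₁ A₂₂) volume =
      ENNReal.ofReal |(fromBlocks A₁₁ A₁₂ A₂₁ A₂₂).det|⁻¹ • volume := by
  have hp := volume_measurePreserving_sumPiEquivProdPi (fun _ : Fin d ⊕ Fin d => ℝ)
  have hps := volume_measurePreserving_sumPiEquivProdPi_symm (fun _ : Fin d ⊕ Fin d => ℝ)
  set e := MeasurableEquiv.sumPiEquivProdPi (fun _ : Fin d ⊕ Fin d => ℝ)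
  have hM := Real.map_matrix_volume_pi_eq_smul_volume_pi hA
  have hcomp : blockMap A₁₁ A₁₂ A₂₁ A₂₂ =
      e ∘ (toLin' (fromBlocks A₁₁ A₁₂ A₂₁ A₂₂)) ∘ e.symm := by
    funext z
    have hz : e.symm z = Sum.elim z.1 z.2 := by
      funext i; cases i <;> rfl
    simp only [Function.comp_apply, hz, toLin'_apply, fromBlocks_mulVec]
    rfl
  have hlin : Measurable (toLin' (fromBlocks A₁₁ A₁₂ A₂₁ A₂₂)) :=
    (LinearMap.continuous_on_pi _).measurable
  rw [hcomp, ← Measure.map_map e.measurable (hlin.comp e.symm.measurable),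
    ← Measure.map_map hlin e.symm.measurable, hps.map_eq, hM, Measure.map_smul, hp.map_eq, abs_inv]

theorem exists_antilipschitzWith_blockMap (hA : (fromBlocks A₁₁ A₁₂ A₂₁ A₂₂).det ≠ 0)
    (x : Fin d → ℝ) : ∃ K, AntilipschitzWith K fun y => blockMap A₁₁ A₁₂ A₂₁ A₂₂ (x, y) := by
  let L : (Fin d → ℝ) →ₗ[ℝ] (Fin d → ℝ) × (Fin d → ℝ) := A₁₂.mulVecLin.prod A₂₂.mulVecLin
  have hL : LinearMap.ker L = ⊥ := by
    rw [LinearMap.ker_eq_bot']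
    intro y hy
    obtain ⟨h1, h2⟩ := Prod.ext_iff.1 hy
    have h0 : fromBlocks A₁₁ A₁₂ A₂₁ A₂₂ *ᵥ Sum.elim 0 y = 0 := by
      rw [fromBlocks_mulVec]
      funext i
      cases i
      · simpa [L] using congrFun h1 _
      · simpa [L] using congrFun h2 _
    funext i
    simpa using congrFun (eq_zero_of_mulVec_eq_zero hA h0) (Sum.inr i)
  obtain ⟨K, -, hK⟩ := L.exists_antilipschitzWith hL
  refine ⟨K, fun y z => (hK y z).trans_eq ?_⟩
  have h (y) : blockMap A₁₁ A₁₂ A₂₁ A₂₂ (x, y) = (A₁₁.mulVec x, A₂₁.mulVec x) + L y := rfl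
  simp only [h, edist_add_left]

theorem hasTemperateGrowth_blockMap (x : Fin d → ℝ) :
    (fun y => blockMap A₁₁ A₁₂ A₂₁ A₂₂ (x, y)).HasTemperateGrowth := by
  let L : (Fin d → ℝ) →L[ℝ] (Fin d → ℝ) × (Fin d → ℝ) :=
    (A₁₂.mulVecLin.prod A₂₂.mulVecLin).toContinuousLinearMap
  exact (Function.HasTemperateGrowth.const (A₁₁.mulVec x, A₂₁.mulVec x)).add L.hasTemperateGrowth

/-- For fixed `x`, the function `y ↦ h (A (x, y))` is Schwartz. -/
theorem exists_schwartz_comp_blockMap (hA : (fromBlocks A₁₁ A₁₂ A₂₁ A₂₂).det ≠ 0)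
    (h : 𝓢((Fin d → ℝ) × (Fin d → ℝ), ℂ)) (x : Fin d → ℝ) :
    ∃ s : 𝓢(Fin d → ℝ, ℂ), ∀ y, s y = h (blockMap A₁₁ A₁₂ A₂₁ A₂₂ (x, y)) := by
  obtain ⟨K, hK⟩ := exists_antilipschitzWith_blockMap hA x
  exact ⟨SchwartzMap.compCLMOfAntilipschitz ℂ (hasTemperateGrowth_blockMap x) hK h, fun _ => rfl⟩

end Block

section Fourier

variable {d : ℕ}

/-- The Fourier transform on `ℝ^d`, written with the dot product on `Fin d → ℝ`. -/
noncomputable def dotFourier (f : (Fin d → ℝ) → ℂ) (ω : Fin d → ℝ) : ℂ :=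
  ∫ y, Complex.exp (-2 * (Real.pi : ℂ) * Complex.I * ((ω ⬝ᵥ y : ℝ) : ℂ)) * f y

/-- A Schwartz function on `Fin d → ℝ`, regarded as a function on Euclidean space. -/
noncomputable def SchwartzMap.toEuclidean (f : 𝓢(Fin d → ℝ, ℂ)) :
    𝓢(EuclideanSpace ℝ (Fin d), ℂ) :=
  compCLMOfContinuousLinearEquiv ℂ (EuclideanSpace.equiv (Fin d) ℝ) f

theorem SchwartzMap.toEuclidean_toLp (f : 𝓢(Fin d → ℝ, ℂ)) (x : Fin d → ℝ) :
    f.toEuclidean (WithLp.toLp 2 x) = f x := rfl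

theorem integral_comp_toLp (F : EuclideanSpace ℝ (Fin d) → ℂ) :
    ∫ x : Fin d → ℝ, F (WithLp.toLp 2 x) = ∫ v, F v :=
  (PiLp.volume_preserving_toLp (Fin d)).integral_comp
    (MeasurableEquiv.toLp 2 (Fin d → ℝ)).measurableEmbedding F

theorem dotFourier_eq_fourier (f : 𝓢(Fin d → ℝ, ℂ)) (ω : Fin d → ℝ) :
    dotFourier f ω = 𝓕 f.toEuclidean (WithLp.toLp 2 ω) := by
  rw [SchwartzMap.fourier_coe, Real.fourier_eq', ← integral_comp_toLp]
  refine integral_congr_ae (ae_of_all _ fun y => ?_)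
  simp only [SchwartzMap.toEuclidean_toLp, smul_eq_mul, EuclideanSpace.inner_toLp_toLp, star_trivial]
  congr 2
  push_cast
  ring

/-- Parseval's identity for `dotFourier` on Schwartz functions. -/
theorem integral_dotFourier_mul_conj (f g : 𝓢(Fin d → ℝ, ℂ)) :
    ∫ ω, dotFourier f ω * conj (dotFourier g ω) = ∫ y, f y * conj (g y) := by
  simp only [dotFourier_eq_fourier, ← SchwartzMap.toEuclidean_toLp]
  rw [integral_comp_toLp fun v => 𝓕 f.toEuclidean v * conj (𝓕 g.toEuclidean v),
    integral_comp_toLp fun v => f.toEuclidean v * conj (g.toEuclidean v)]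
  exact SchwartzMap.integral_inner_fourier_fourier g.toEuclidean f.toEuclidean

theorem eLpNorm_dotFourier (f : 𝓢(Fin d → ℝ, ℂ)) :
    eLpNorm (dotFourier f) 2 volume = eLpNorm f 2 volume := by
  have hp := PiLp.volume_preserving_toLp (Fin d)
  have h1 : dotFourier f =
      ⇑(𝓕 f.toEuclidean : 𝓢(EuclideanSpace ℝ (Fin d), ℂ)) ∘ WithLp.toLp 2 :=
    funext (dotFourier_eq_fourier f)
  have h2 : (f : (Fin d → ℝ) → ℂ) = f.toEuclidean ∘ WithLp.toLp 2 := rfl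
  rw [h1, h2, eLpNorm_comp_measurePreserving (SchwartzMap.continuous _).aestronglyMeasurable hp,
    eLpNorm_comp_measurePreserving (SchwartzMap.continuous _).aestronglyMeasurable hp]
  have h := SchwartzMap.norm_fourier_toL2_eq f.toEuclidean
  rw [SchwartzMap.norm_toLp, SchwartzMap.norm_toLp] at h
  exact (ENNReal.toReal_eq_toReal_iff' (SchwartzMap.eLpNorm_lt_top _ _ _).ne
    (SchwartzMap.eLpNorm_lt_top _ _ _).ne).1 h

end Fourier

section Wigner

variable {d : ℕ} {A₁₁ A₁₂ A₂₁ A₂₂ : Matrix (Fin d) (Fin d) ℝ}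

theorem mwd_eq_dotFourier (f g : 𝓢(Fin d → ℝ, ℂ)) (x ω : Fin d → ℝ) :
    mwd A₁₁ A₁₂ A₂₁ A₂₂ f g x ω =
      dotFourier (fun y => f.tensor g.conjugate (blockMap A₁₁ A₁₂ A₂₁ A₂₂ (x, y))) ω := by
  simp only [mwd, dotFourier, SchwartzMap.tensor_apply, SchwartzMap.conjugate_apply, blockMap,
    mul_assoc]

theorem stronglyMeasurable_mwd (f g : 𝓢(Fin d → ℝ, ℂ)) :
    StronglyMeasurable fun z : (Fin d → ℝ) × (Fin d → ℝ) =>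
      mwd A₁₁ A₁₂ A₂₁ A₂₂ f g z.1 z.2 := by
  refine StronglyMeasurable.integral_prod_right'
    (f := fun p : ((Fin d → ℝ) × (Fin d → ℝ)) × (Fin d → ℝ) =>
      Complex.exp (-2 * (Real.pi : ℂ) * Complex.I * ((p.1.2 ⬝ᵥ p.2 : ℝ) : ℂ)) *
      f (A₁₁.mulVec p.1.1 + A₁₂.mulVec p.2) * conj (g (A₂₁.mulVec p.1.1 + A₂₂.mulVec p.2)))
    (Continuous.stronglyMeasurable ?_)
  have hf := f.continuous
  have hg := g.continuous
  fun_prop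

theorem eLpNorm_mwd (hA : (fromBlocks A₁₁ A₁₂ A₂₁ A₂₂).det ≠ 0) (f g : 𝓢(Fin d → ℝ, ℂ)) :
    eLpNorm (fun z : (Fin d → ℝ) × (Fin d → ℝ) => mwd A₁₁ A₁₂ A₂₁ A₂₂ f g z.1 z.2) 2 volume =
      ENNReal.ofReal (|(fromBlocks A₁₁ A₁₂ A₂₁ A₂₂).det| ^ (-(2⁻¹ : ℝ))) *
        eLpNorm f 2 volume * eLpNorm g 2 volume := by
  set h := f.tensor g.conjugate with hh
  have hcont : Continuous (h ∘ blockMap A₁₁ A₁₂ A₂₁ A₂₂) := h.continuous.comp continuous_blockMap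
  have hdet : 0 < |(fromBlocks A₁₁ A₁₂ A₂₁ A₂₂).det| := abs_pos.2 hA
  calc eLpNorm (fun z : (Fin d → ℝ) × (Fin d → ℝ) => mwd A₁₁ A₁₂ A₂₁ A₂₂ f g z.1 z.2) 2 volume
      = eLpNorm (h ∘ blockMap A₁₁ A₁₂ A₂₁ A₂₂) 2 volume := by
        apply eLpNorm_two_eq_of_lintegral_eq
        rw [Measure.volume_eq_prod,
          lintegral_prod _ ((stronglyMeasurable_mwd f g).enorm.pow_const 2).aemeasurable,
          lintegral_prod _ (hcont.measurable.enorm.pow_const 2).aemeasurable]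
        refine lintegral_congr fun x => ?_
        obtain ⟨s, hs⟩ := exists_schwartz_comp_blockMap hA h x
        simp only [mwd_eq_dotFourier, Function.comp_apply, ← hh, ← hs]
        rw [← eLpNorm_two_sq, ← eLpNorm_two_sq, eLpNorm_dotFourier]
    _ = ENNReal.ofReal |(fromBlocks A₁₁ A₁₂ A₂₁ A₂₂).det|⁻¹ ^ (2⁻¹ : ℝ) *
          eLpNorm h 2 volume := by
        rw [← eLpNorm_map_measure h.continuous.aestronglyMeasurable
          continuous_blockMap.aemeasurable, map_blockMap_volume hA,
          eLpNorm_smul_measure_of_ne_top (by simp)]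
        simp
    _ = _ := by
        rw [ENNReal.ofReal_rpow_of_pos (inv_pos.2 hdet), Real.inv_rpow hdet.le,
          ← Real.rpow_neg hdet.le, mul_assoc, ← g.eLpNorm_conjugate, Measure.volume_eq_prod]
        congr 1
        exact eLpNorm_two_prod_mul f.continuous.aestronglyMeasurable
          g.conjugate.continuous.aestronglyMeasurable

theorem memLp_mwd (hA : (fromBlocks A₁₁ A₁₂ A₂₁ A₂₂).det ≠ 0) (f g : 𝓢(Fin d → ℝ, ℂ)) :
    MemLp (fun z : (Fin d → ℝ) × (Fin d → ℝ) => mwd A₁₁ A₁₂ A₂₁ A₂₂ f g z.1 z.2) 2 volume := by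
  refine ⟨(stronglyMeasurable_mwd f g).aestronglyMeasurable, ?_⟩
  rw [eLpNorm_mwd hA]
  exact ENNReal.mul_lt_top (ENNReal.mul_lt_top ENNReal.ofReal_lt_top (f.memLp 2 volume).2)
    (g.memLp 2 volume).2

theorem integral_mwd_mul_conj (hA : (fromBlocks A₁₁ A₁₂ A₂₁ A₂₂).det ≠ 0)
    (f₁ f₂ g₁ g₂ : 𝓢(Fin d → ℝ, ℂ)) :
    (∫ z : (Fin d → ℝ) × (Fin d → ℝ), mwd A₁₁ A₁₂ A₂₁ A₂₂ f₁ g₁ z.1 z.2 *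
        conj (mwd A₁₁ A₁₂ A₂₁ A₂₂ f₂ g₂ z.1 z.2)) =
      ((|(fromBlocks A₁₁ A₁₂ A₂₁ A₂₂).det|⁻¹ : ℝ) : ℂ) *
        (∫ t : Fin d → ℝ, f₁ t * conj (f₂ t)) * conj (∫ t : Fin d → ℝ, g₁ t * conj (g₂ t)) := by
  set h₁ := f₁.tensor g₁.conjugate with hh₁
  set h₂ := f₂.tensor g₂.conjugate with hh₂
  have : (volume : Measure ((Fin d → ℝ) × (Fin d → ℝ))).IsAddHaarMeasure :=
    Measure.prod.instIsAddHaarMeasure _ _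
  have hint : Integrable fun z => h₁ z * conj (h₂ z) :=
    (h₁.memLp 2).integrable_mul (h₂.memLp 2).star
  have hintA : Integrable fun z => h₁ (blockMap A₁₁ A₁₂ A₂₁ A₂₂ z) *
      conj (h₂ (blockMap A₁₁ A₁₂ A₂₁ A₂₂ z)) := by
    refine Integrable.comp_measurable (g := fun z => h₁ z * conj (h₂ z)) ?_
      continuous_blockMap.measurable
    rw [map_blockMap_volume hA]
    exact hint.smul_measure ENNReal.ofReal_ne_top
  have hmwd : Integrable fun z : (Fin d → ℝ) × (Fin d → ℝ) =>
      mwd A₁₁ A₁₂ A₂₁ A₂₂ f₁ g₁ z.1 z.2 * conj (mwd A₁₁ A₁₂ A₂₁ A₂₂ f₂ g₂ z.1 z.2) :=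
    (memLp_mwd hA f₁ g₁).integrable_mul (memLp_mwd hA f₂ g₂).star
  calc ∫ z : (Fin d → ℝ) × (Fin d → ℝ), mwd A₁₁ A₁₂ A₂₁ A₂₂ f₁ g₁ z.1 z.2 *
        conj (mwd A₁₁ A₁₂ A₂₁ A₂₂ f₂ g₂ z.1 z.2)
      = ∫ z, h₁ (blockMap A₁₁ A₁₂ A₂₁ A₂₂ z) * conj (h₂ (blockMap A₁₁ A₁₂ A₂₁ A₂₂ z)) := by
        rw [Measure.volume_eq_prod, integral_prod _ hmwd, integral_prod _ hintA]
        refine integral_congr_ae (ae_of_all _ fun x => ?_)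
        obtain ⟨s₁, hs₁⟩ := exists_schwartz_comp_blockMap hA h₁ x
        obtain ⟨s₂, hs₂⟩ := exists_schwartz_comp_blockMap hA h₂ x
        simp only [mwd_eq_dotFourier, ← hh₁, ← hh₂, ← hs₁, ← hs₂]
        exact integral_dotFourier_mul_conj s₁ s₂
    _ = |(fromBlocks A₁₁ A₁₂ A₂₁ A₂₂).det|⁻¹ * ∫ z, h₁ z * conj (h₂ z) := by
        rw [← integral_map (f := fun z => h₁ z * conj (h₂ z)) continuous_blockMap.aemeasurable,
          map_blockMap_volume hA, integral_smul_measure,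
          ENNReal.toReal_ofReal (inv_nonneg.2 (abs_nonneg _)), Complex.real_smul]
        · rw [map_blockMap_volume hA]
          exact hint.aestronglyMeasurable.smul_measure _
    _ = _ := by
        rw [mul_assoc, Complex.ofReal_inv, ← integral_conj, ← integral_prod_mul]
        congr 1
        refine integral_congr_ae (ae_of_all _ fun z => ?_)
        simp only [hh₁, hh₂, SchwartzMap.tensor_apply, SchwartzMap.conjugate_apply, map_mul,
          Complex.conj_conj]
        ring

end Wigner

/-- Orthogonality relations (Moyal-type formula) for matrix-Wigner distributions, together
with the resulting `L²`-norm identity. -/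
theorem mwd_orthogonality {d : ℕ} (A₁₁ A₁₂ A₂₁ A₂₂ : Matrix (Fin d) (Fin d) ℝ)
    (hA : (Matrix.fromBlocks A₁₁ A₁₂ A₂₁ A₂₂).det ≠ 0)
    (f₁ f₂ g₁ g₂ : SchwartzMap ((Fin d) → ℝ) ℂ) :
    (∫ z : (Fin d → ℝ) × (Fin d → ℝ),
        mwd A₁₁ A₁₂ A₂₁ A₂₂ (⇑f₁) (⇑g₁) z.1 z.2 *
          conj (mwd A₁₁ A₁₂ A₂₁ A₂₂ (⇑f₂) (⇑g₂) z.1 z.2))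
      = ((|(Matrix.fromBlocks A₁₁ A₁₂ A₂₁ A₂₂).det|⁻¹ : ℝ) : ℂ) *
        (∫ t : Fin d → ℝ, f₁ t * conj (f₂ t)) *
        conj (∫ t : Fin d → ℝ, g₁ t * conj (g₂ t)) ∧
    ∀ f g : SchwartzMap ((Fin d) → ℝ) ℂ,
      eLpNorm (fun z : (Fin d → ℝ) × (Fin d → ℝ) =>
          mwd A₁₁ A₁₂ A₂₁ A₂₂ (⇑f) (⇑g) z.1 z.2) 2 volume =
        ENNReal.ofReal (|(Matrix.fromBlocks A₁₁ A₁₂ A₂₁ A₂₂).det| ^ (-(2⁻¹ : ℝ))) *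
          eLpNorm (⇑f) 2 volume * eLpNorm (⇑g) 2 volume := by
  exact ⟨integral_mwd_mul_conj hA f₁ f₂ g₁ g₂, eLpNorm_mwd hA⟩
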